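/- Fix n ≥ 1 and let G be the n×n matrix with entries G_{ij} = 2/(2i + 2j − 1) for 1 ≤ i, j ≤ n (so G_{ij} = ∫_{-1}^{1} x^{2(i-1)+1} x^{2(j-1)+1} dx). Then G is invertible and its inverse B has entries B_{ij} = Σ_{k=max(i,j)}^{n} ((4k − 1)/2) · a_{ki} a_{kj}, where a_{ki} = ((-1)^{k+i} / (k−1)!) · binom(k−1, i−1) · Γ(i + 1/2 + (k−1)) / Γ(i + 1/2). -/

import Mathlib

/-- Coefficients of the odd Legendre polynomial `P_{2(k-1)+1}` in ascending odd powers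
(indices running from `1`). -/
noncomputable def oddLegendreCoeff (k i : ℕ) : ℝ :=
  (-1) ^ (k + i) / ((k - 1).factorial : ℝ) * ((k - 1).choose (i - 1) : ℝ) *
    Real.Gamma ((i : ℝ) + 1 / 2 + ((k : ℝ) - 1)) / Real.Gamma ((i : ℝ) + 1 / 2)

open Finset Polynomial

theorem fwdDiff_iter_inv (k : ℕ) {c : ℝ} (hc : 0 < c) :
    (fwdDiff (1 : ℝ))^[k] (fun x : ℝ ↦ x⁻¹) c =
      (-1) ^ k * (k.factorial : ℝ) / (ascPochhammer ℝ (k + 1)).eval c := by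
  induction k generalizing c with
  | zero => simp
  | succ k ih =>
    have h₁ : 0 < (ascPochhammer ℝ (k + 1)).eval c := ascPochhammer_pos _ _ hc
    have h₂ : 0 < (ascPochhammer ℝ (k + 1)).eval (c + 1) := ascPochhammer_pos _ _ (by linarith)
    have hr : (ascPochhammer ℝ (k + 1 + 1)).eval c =
        (ascPochhammer ℝ (k + 1)).eval c * (c + (k + 1 : ℕ)) := ascPochhammer_succ_eval ..
    have hl : (ascPochhammer ℝ (k + 1 + 1)).eval c =
        c * (ascPochhammer ℝ (k + 1)).eval (c + 1) := by
      rw [ascPochhammer_succ_left]; simp [eval_comp]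
    have e₁ : 1 / (ascPochhammer ℝ (k + 1)).eval c =
        (c + k + 1) / (ascPochhammer ℝ (k + 1 + 1)).eval c := by
      rw [hr]; push_cast; field_simp; ring
    have e₂ : 1 / (ascPochhammer ℝ (k + 1)).eval (c + 1) =
        c / (ascPochhammer ℝ (k + 1 + 1)).eval c := by
      rw [hl]; field_simp
    rw [Function.iterate_succ_apply', fwdDiff, ih hc, ih (by linarith),
      ← mul_one_div _ (eval (c + 1) _), ← mul_one_div _ (eval c (ascPochhammer ℝ (k + 1))), e₁, e₂,
      Nat.factorial_succ]
    push_cast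
    ring

theorem neg_one_pow_sub_eq_add {k i : ℕ} (h : i ≤ k) : (-1 : ℝ) ^ (k - i) = (-1) ^ (k + i) := by
  obtain ⟨m, rfl⟩ := Nat.exists_eq_add_of_le h
  rw [Nat.add_sub_cancel_left, show i + m + i = m + 2 * i by ring, pow_add, pow_mul]
  simp

/-- The alternating binomial sum of `p(i) / (i + c)` for a polynomial of degree at most `k`. -/
theorem sum_alternating_choose_mul_eval_div {p : ℝ[X]} {k : ℕ} (hp : p.natDegree ≤ k)
    {c : ℝ} (hc : 0 < c) :
    ∑ i ∈ range (k + 1), (-1) ^ (k + i) * (k.choose i : ℝ) * (p.eval (i : ℝ) / (i + c)) =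
      p.eval (-c) * ((-1) ^ k * (k.factorial : ℝ) / (ascPochhammer ℝ (k + 1)).eval c) := by
  have hsum (f : ℝ → ℝ) (y : ℝ) : (fwdDiff (1 : ℝ))^[k] f y =
      ∑ i ∈ range (k + 1), (-1) ^ (k + i) * (k.choose i : ℝ) * f (y + i) := by
    rw [fwdDiff_iter_eq_sum_shift]
    refine sum_congr rfl fun i hi ↦ ?_
    rw [← neg_one_pow_sub_eq_add (mem_range_succ_iff.mp hi)]
    simp
  set q := p /ₘ (X - C (-c)) with hq
  have hpq (x : ℝ) : p.eval x = p.eval (-c) + (x + c) * q.eval x := by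
    conv_lhs => rw [← modByMonic_add_div p (X - C (-c)), modByMonic_X_sub_C_eq_C_eval]
    simp [hq]
  have hq₀ : (fwdDiff (1 : ℝ))^[k] q.eval 0 = 0 := by
    rcases Nat.eq_zero_or_pos k with rfl | hk
    · have : q = 0 := by
        rw [hq, divByMonic_eq_zero_iff (monic_X_sub_C _), degree_X_sub_C]
        exact lt_of_le_of_lt degree_le_natDegree (by exact_mod_cast Nat.lt_succ_of_le hp)
      simp [this]
    · have hlt : q.natDegree < k := by
        rw [hq, natDegree_divByMonic _ (monic_X_sub_C _), natDegree_X_sub_C]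
        omega
      rw [fwdDiff_iter_eq_zero_of_degree_lt hlt]; rfl
  rw [← fwdDiff_iter_inv k hc, hsum, mul_sum]
  rw [hsum] at hq₀
  rw [← add_zero (∑ _ ∈ _, eval _ p * _), ← hq₀, ← sum_add_distrib]
  refine sum_congr rfl fun i _ ↦ ?_
  have : (i : ℝ) + c ≠ 0 := by positivity
  rw [hpq i, zero_add, add_comm c]
  field_simp

theorem Real.Gamma_add_natCast {x : ℝ} (hx : 0 < x) (k : ℕ) :
    Real.Gamma (x + k) = (ascPochhammer ℝ k).eval x * Real.Gamma x := by
  induction k with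
  | zero => simp
  | succ k ih =>
    rw [ascPochhammer_succ_eval, Nat.cast_succ, ← add_assoc, Real.Gamma_add_one (by positivity), ih]
    ring

theorem oddLegendreCoeff_succ (k i : ℕ) :
    oddLegendreCoeff (k + 1) (i + 1) =
      (-1) ^ (k + i) * (k.choose i : ℝ) * (ascPochhammer ℝ k).eval ((i : ℝ) + 3 / 2) /
        (k.factorial : ℝ) := by
  have hx : (0 : ℝ) < (i : ℝ) + 3 / 2 := by positivity
  have hG := (Real.Gamma_pos_of_pos hx).ne'
  have e₁ : ((i + 1 : ℕ) : ℝ) + 1 / 2 = (i : ℝ) + 3 / 2 := by push_cast; ring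
  have e₂ : ((k + 1 : ℕ) : ℝ) - 1 = k := by push_cast; ring
  rw [oddLegendreCoeff, e₁, e₂, Real.Gamma_add_natCast hx,
    show k + 1 + (i + 1) = k + i + 2 by ring, pow_add]
  simp only [Nat.add_sub_cancel]
  field_simp

theorem oddLegendreCoeff_eq_zero_of_lt {k i : ℕ} (h : k < i) :
    oddLegendreCoeff (k + 1) (i + 1) = 0 := by
  simp [oddLegendreCoeff_succ, Nat.choose_eq_zero_of_lt h]

/-- The `L²(-1, 1)` pairing of the `k`-th odd Legendre polynomial with `x ^ (2 * j + 1)`. -/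
theorem sum_oddLegendreCoeff_mul (k j : ℕ) :
    ∑ i ∈ range (k + 1), oddLegendreCoeff (k + 1) (i + 1) * (2 / (2 * i + 2 * j + 3)) =
      (ascPochhammer ℝ k).eval (-(j : ℝ)) * (-1) ^ k /
        (ascPochhammer ℝ (k + 1)).eval ((j : ℝ) + 3 / 2) := by
  have hdeg : ((ascPochhammer ℝ k).comp (X + C (3 / 2))).natDegree ≤ k := by
    rw [natDegree_comp, natDegree_X_add_C, ascPochhammer_natDegree, mul_one]
  have h := sum_alternating_choose_mul_eval_div hdeg (c := (j : ℝ) + 3 / 2) (by positivity)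
  simp only [eval_comp, eval_add, eval_X, eval_C] at h
  rw [show -((j : ℝ) + 3 / 2) + 3 / 2 = -j by ring] at h
  have hf : (k.factorial : ℝ) ≠ 0 := by positivity
  calc _ = (∑ i ∈ range (k + 1), (-1) ^ (k + i) * (k.choose i : ℝ) *
        ((ascPochhammer ℝ k).eval ((i : ℝ) + 3 / 2) / (i + (j + 3 / 2)))) / k.factorial := by
        rw [sum_div]
        refine sum_congr rfl fun i _ ↦ ?_
        rw [oddLegendreCoeff_succ,
          show (2 : ℝ) / (2 * i + 2 * j + 3) = 1 / (i + (j + 3 / 2)) by field_simp; ring]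
        ring
    _ = _ := by rw [h]; field_simp

theorem sum_oddLegendreCoeff_mul_of_lt {k j : ℕ} (h : j < k) :
    ∑ i ∈ range (k + 1), oddLegendreCoeff (k + 1) (i + 1) * (2 / (2 * i + 2 * j + 3)) = 0 := by
  rw [sum_oddLegendreCoeff_mul, ascPochhammer_eval_neg_coe_nat_of_lt h]
  simp

theorem oddLegendreCoeff_self_mul_sum (k : ℕ) :
    oddLegendreCoeff (k + 1) (k + 1) *
      ∑ i ∈ range (k + 1), oddLegendreCoeff (k + 1) (i + 1) * (2 / (2 * i + 2 * k + 3)) =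
      2 / (4 * k + 3) := by
  have hneg : (ascPochhammer ℝ k).eval (-(k : ℝ)) = (-1) ^ k * k.factorial := by
    rw [ascPochhammer_eval_neg_eq_descPochhammer, descPochhammer_eval_eq_descFactorial,
      Nat.descFactorial_self]
  have hpos : 0 < (ascPochhammer ℝ k).eval ((k : ℝ) + 3 / 2) :=
    ascPochhammer_pos _ _ (by positivity)
  have hf : (k.factorial : ℝ) ≠ 0 := by positivity
  rw [sum_oddLegendreCoeff_mul, hneg, oddLegendreCoeff_succ, ascPochhammer_succ_eval, pow_add,
    Nat.choose_self]
  generalize (ascPochhammer ℝ k).eval ((k : ℝ) + 3 / 2) = y at hpos ⊢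
  rcases neg_one_pow_eq_or ℝ k with hs | hs <;> rw [hs] <;> field_simp <;> ring

/-- Orthogonality of the odd Legendre polynomials in `L²(-1, 1)`, in coefficients. -/
theorem sum_oddLegendreCoeff_mul_sum {n : ℕ} (k l : Fin n) :
    ∑ j : Fin n, (∑ i : Fin n, oddLegendreCoeff (k + 1) (i + 1) * (2 / (2 * i + 2 * j + 3))) *
      oddLegendreCoeff (l + 1) (j + 1) = if k = l then (2 : ℝ) / (4 * k + 3) else 0 := by
  have hext (k : Fin n) (g : ℕ → ℝ) : ∑ i : Fin n, oddLegendreCoeff (k + 1) (i + 1) * g i =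
      ∑ i ∈ range (k + 1), oddLegendreCoeff (k + 1) (i + 1) * g i := by
    rw [Fin.sum_univ_eq_sum_range (fun i ↦ oddLegendreCoeff (k + 1) (i + 1) * g i) n]
    refine (sum_subset (range_subset_range.mpr k.isLt) fun i _ hi ↦ ?_).symm
    rw [oddLegendreCoeff_eq_zero_of_lt (by simpa using hi), zero_mul]
  have hle (k l : Fin n) (h : l ≤ k) :
      ∑ j : Fin n, (∑ i : Fin n, oddLegendreCoeff (k + 1) (i + 1) * (2 / (2 * i + 2 * j + 3))) *
      oddLegendreCoeff (l + 1) (j + 1) = if k = l then (2 : ℝ) / (4 * k + 3) else 0 := by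
    rw [sum_eq_single l]
    · rw [hext k fun i ↦ 2 / (2 * i + 2 * (l : ℕ) + 3)]
      split_ifs with hkl
      · subst hkl
        rw [mul_comm, oddLegendreCoeff_self_mul_sum]
      · rw [sum_oddLegendreCoeff_mul_of_lt (lt_of_le_of_ne h (Ne.symm hkl) : l < k), zero_mul]
    · intro j _ hj
      rcases lt_or_gt_of_ne hj with hjl | hlj
      · rw [hext k fun i ↦ 2 / (2 * i + 2 * (j : ℕ) + 3),
          sum_oddLegendreCoeff_mul_of_lt (lt_of_lt_of_le hjl h), zero_mul]
      · rw [oddLegendreCoeff_eq_zero_of_lt hlj, mul_zero]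
    · simp
  rcases le_total l k with h | h
  · exact hle k l h
  · have := hle l k h
    simp only [sum_mul] at this ⊢
    rw [sum_comm]
    convert this using 1
    · refine sum_congr rfl fun i _ ↦ sum_congr rfl fun j _ ↦ ?_
      rw [add_comm (2 * (j : ℝ))]
      ring
    · by_cases hkl : k = l
      · simp [hkl]
      · simp [hkl, Ne.symm hkl]

/-- The inverse of the Gram matrix `G i j = 2/(2i + 2j − 1)` (indices running from `1` to
`n`) of the odd monomials `x, x³, …, x^{2(n-1)+1}` on `(-1, 1)`:
`(G⁻¹) i j = ∑_{k ≥ max i j} ((4k−1)/2) a_{ki} a_{kj}`. -/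
theorem oddLegendre_gram_inverse (n : ℕ) (hn : 1 ≤ n)
    (G : Matrix (Fin n) (Fin n) ℝ)
    (hG : ∀ i j : Fin n,
      G i j = 2 / (2 * ((i : ℕ) + 1 : ℝ) + 2 * ((j : ℕ) + 1 : ℝ) - 1)) :
    IsUnit G ∧
      ∀ i j : Fin n,
        G⁻¹ i j =
          ∑ k ∈ Finset.univ.filter (fun k : Fin n => max i j ≤ k),
            ((4 * ((k : ℕ) + 1 : ℝ) - 1) / 2) *
              oddLegendreCoeff ((k : ℕ) + 1) ((i : ℕ) + 1) *
              oddLegendreCoeff ((k : ℕ) + 1) ((j : ℕ) + 1) := by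
  let A : Matrix (Fin n) (Fin n) ℝ := .of fun k i ↦ oddLegendreCoeff (k + 1) (i + 1)
  let D : Matrix (Fin n) (Fin n) ℝ := .diagonal fun k ↦ (4 * (k : ℝ) + 3) / 2
  have hAGA : A * G * A.transpose * D = 1 := by
    have hdiag : A * G * A.transpose = .diagonal fun k : Fin n ↦ 2 / (4 * (k : ℝ) + 3) := by
      ext k l
      rw [Matrix.diagonal_apply, ← sum_oddLegendreCoeff_mul_sum]
      simp only [Matrix.mul_apply, Matrix.transpose_apply, A, Matrix.of_apply, hG]
      refine sum_congr rfl fun j _ ↦ ?_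
      congr 1
      refine sum_congr rfl fun i _ ↦ ?_
      congr 2
      ring
    rw [hdiag, Matrix.diagonal_mul_diagonal, ← Matrix.diagonal_one]
    congr 1
    ext k
    have : 4 * (k : ℝ) + 3 ≠ 0 := by positivity
    field_simp
  have hGB : G * (A.transpose * D * A) = 1 := by
    rw [Matrix.mul_assoc, Matrix.mul_assoc] at hAGA
    simpa only [Matrix.mul_assoc] using mul_eq_one_comm.mp hAGA
  refine ⟨IsUnit.of_mul_eq_one _ hGB, fun i j ↦ ?_⟩
  rw [Matrix.inv_eq_right_inv hGB, Matrix.mul_apply, sum_filter]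
  refine sum_congr rfl fun k _ ↦ ?_
  simp only [D, Matrix.mul_diagonal, Matrix.transpose_apply, A, Matrix.of_apply]
  split_ifs with h
  · ring
  · rcases lt_max_iff.mp (not_le.mp h) with h | h
    · rw [oddLegendreCoeff_eq_zero_of_lt h]; ring
    · rw [oddLegendreCoeff_eq_zero_of_lt h]; ring
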